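/- Let K be a field and (V, B) a symplectic K-vector space of dimension 2g. Let (F_i)_{0≤i≤2g} and (G_j)_{0≤j≤2g} be two complete symplectic flags in V, and let π ∈ S_{2g} be the unique permutation with dim_K(F_i ∩ G_j) = #{k ∈ {1,...,2g} : k ≤ i and π(k) ≤ j} for all 0 ≤ i, j ≤ 2g. Then π(i) + π(2g+1−i) = 2g+1 for all i = 1,...,g, i.e. π is a symplectic permutation. -/

import Mathlib

/-- The orthogonal of a submodule `N` with respect to a bilinear form `B`:
`N^⊥ = {x ∈ M : B(x, n) = 0 for all n ∈ N}`. -/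
def bilinOrthogonal {R M : Type*} [CommRing R] [AddCommGroup M] [Module R M]
    (B : M →ₗ[R] M →ₗ[R] R) (N : Submodule R M) : Submodule R M where
  carrier := {x | ∀ n ∈ N, B x n = 0}
  add_mem' := by
    intro a b ha hb n hn
    simp [map_add, ha n hn, hb n hn]
  zero_mem' := by
    intro n hn
    simp
  smul_mem' := by
    intro c x hx n hn
    simp [map_smul, hx n hn]

/-- A permutation of `Fin n` is determined by its rank function. -/
theorem perm_eq_of_card_filter_eq {n : ℕ} {σ τ : Equiv.Perm (Fin n)}
    (h : ∀ i j : ℕ, i ≤ n → j ≤ n →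
      (Finset.univ.filter fun k : Fin n => (k : ℕ) < i ∧ (σ k : ℕ) < j).card =
        (Finset.univ.filter fun k : Fin n => (k : ℕ) < i ∧ (τ k : ℕ) < j).card) :
    σ = τ := by
  have step (ρ : Equiv.Perm (Fin n)) (i : Fin n) (j : ℕ) :
      (Finset.univ.filter fun k : Fin n => (k : ℕ) < i + 1 ∧ (ρ k : ℕ) < j).card =
        (Finset.univ.filter fun k : Fin n => (k : ℕ) < i ∧ (ρ k : ℕ) < j).card +
          if (ρ i : ℕ) < j then 1 else 0 := by
    split_ifs with hj
    · rw [← Finset.card_insert_of_notMem (a := i) (by simp)]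
      congr 1
      ext k
      simp only [Finset.mem_filter_univ, Finset.mem_insert, Fin.ext_iff, Nat.lt_succ_iff_lt_or_eq]
      constructor
      · tauto
      · rintro (hk | hk)
        · obtain rfl := Fin.ext hk
          exact ⟨Or.inr rfl, hj⟩
        · tauto
    · rw [add_zero]
      congr 1
      ext k
      simp only [Finset.mem_filter_univ, Nat.lt_succ_iff_lt_or_eq]
      constructor
      · rintro ⟨hk | hk, hkj⟩
        · exact ⟨hk, hkj⟩
        · obtain rfl := Fin.ext hk
          exact absurd hkj hj
      · tauto
  have key (i : Fin n) (j : ℕ) (hj : j ≤ n) : (σ i : ℕ) < j ↔ (τ i : ℕ) < j := by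
    have h₁ := h (i + 1) j i.isLt hj
    rw [step, step, h i j i.isLt.le hj] at h₁
    split_ifs at h₁ <;> omega
  ext i
  have h₁ := key i (σ i + 1) (σ i).isLt
  have h₂ := key i (τ i + 1) (τ i).isLt
  omega

/-- The rank function of the conjugate of a permutation by `Fin.rev`. -/
theorem card_filter_rev_conj {n : ℕ} (σ : Equiv.Perm (Fin n)) {i j : ℕ} (hi : i ≤ n)
    (hj : j ≤ n) :
    (Finset.univ.filter fun k : Fin n => (k : ℕ) < i ∧ (σ k : ℕ) < j).card + n =
      (Finset.univ.filter fun k : Fin n =>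
        (k : ℕ) < n - i ∧ ((σ k.rev).rev : ℕ) < n - j).card + i + j := by
  have h₁ : (Finset.univ.filter fun k : Fin n => (k : ℕ) < i).card = i := by
    simp [Fin.card_filter_val_lt, hi]
  have h₂ : (Finset.univ.filter fun k : Fin n => (σ k : ℕ) < j).card = j := by
    rw [Finset.card_equiv σ (t := Finset.univ.filter fun k : Fin n => (k : ℕ) < j) (by simp)]
    simp [Fin.card_filter_val_lt, hj]
  have h₃ := Finset.card_union_add_card_inter
    (Finset.univ.filter fun k : Fin n => (k : ℕ) < i)
    (Finset.univ.filter fun k : Fin n => (σ k : ℕ) < j)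
  have h₄ := Finset.card_compl_add_card
    (Finset.univ.filter (fun k : Fin n => (k : ℕ) < i) ∪
      Finset.univ.filter fun k : Fin n => (σ k : ℕ) < j)
  have h₅ : (Finset.univ.filter (fun k : Fin n => (k : ℕ) < i) ∪
      Finset.univ.filter fun k : Fin n => (σ k : ℕ) < j)ᶜ.card =
      (Finset.univ.filter fun k : Fin n =>
        (k : ℕ) < n - i ∧ ((σ k.rev).rev : ℕ) < n - j).card := by
    apply Finset.card_equiv Fin.revPerm
    intro k
    simp only [Finset.mem_compl, Finset.mem_union, Finset.mem_filter_univ, Fin.revPerm_apply,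
      Fin.rev_rev, Fin.val_rev]
    omega
  rw [← Finset.filter_and] at h₃
  rw [Fintype.card_fin] at h₄
  omega

theorem bilinOrthogonal_sup {R M : Type*} [CommRing R] [AddCommGroup M] [Module R M]
    (B : M →ₗ[R] M →ₗ[R] R) (N L : Submodule R M) :
    bilinOrthogonal B (N ⊔ L) = bilinOrthogonal B N ⊓ bilinOrthogonal B L := by
  ext x
  change N ⊔ L ≤ LinearMap.ker (B x) ↔ N ≤ LinearMap.ker (B x) ∧ L ≤ LinearMap.ker (B x)
  exact sup_le_iff

theorem finrank_add_finrank_bilinOrthogonal {K V : Type*} [Field K] [AddCommGroup V]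
    [Module K V] [FiniteDimensional K V] {B : V →ₗ[K] V →ₗ[K] K}
    (halt : ∀ x, B x x = 0) (hnd : ∀ x, (∀ y, B x y = 0) → x = 0) (W : Submodule K V) :
    Module.finrank K W + Module.finrank K (bilinOrthogonal B W) = Module.finrank K V := by
  have hrefl : B.IsRefl := LinearMap.IsAlt.isRefl halt
  have hker : LinearMap.ker B = ⊥ :=
    LinearMap.ker_eq_bot'.2 fun x hx => hnd x fun y => by simp [hx]
  have horth : bilinOrthogonal B W = LinearMap.BilinForm.orthogonal B W := by
    ext x
    exact forall₂_congr fun n _ => ⟨hrefl x n, hrefl n x⟩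
  have h := LinearMap.BilinForm.finrank_add_finrank_orthogonal' (B := B) W
  rwa [hker, inf_bot_eq, finrank_bot, add_zero, ← horth] at h

/-- Let `(V, B)` be a symplectic `K`-vector space of dimension `2g`, let
`(F_i)` and `(G_j)` be two complete symplectic flags in `V` (so `F_i^⊥ = F_{2g-i}`, which in
`0`-indexed form on `Fin (2*g+1)` reads `(F_i)^⊥ = F_{i.rev}`), and let `π` be the permutation
measuring their relative position, i.e. `dim (F_i ∩ G_j) = #{k : k ≤ i and π(k) ≤ j}`.
Then `π` is a symplectic permutation, i.e. `π` commutes with the involution `i ↦ 2g+1-i`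
(which in `0`-indexed form on `Fin (2*g)` is `Fin.rev`). -/
theorem flatness_stmt_12 (K V : Type*) [Field K] [AddCommGroup V] [Module K V]
    [FiniteDimensional K V] (g : ℕ) (hg : 1 ≤ g) (hdim : Module.finrank K V = 2*g)
    (B : V →ₗ[K] V →ₗ[K] K)
    (halt : ∀ x, B x x = 0) (hnd : ∀ x, (∀ y, B x y = 0) → x = 0)
    (F G : Fin (2*g+1) → Submodule K V)
    (hF : Monotone F) (hFrank : ∀ i, Module.finrank K (F i) = (i : ℕ))
    (hFsymp : ∀ i, bilinOrthogonal B (F i) = F i.rev)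
    (hG : Monotone G) (hGrank : ∀ i, Module.finrank K (G i) = (i : ℕ))
    (hGsymp : ∀ i, bilinOrthogonal B (G i) = G i.rev)
    (π : Equiv.Perm (Fin (2*g)))
    (hπ : ∀ i j : Fin (2*g+1),
      Module.finrank K ↥(F i ⊓ G j) =
        (Finset.univ.filter fun k : Fin (2*g) =>
          (k : ℕ) < (i : ℕ) ∧ ((π k : Fin (2*g)) : ℕ) < (j : ℕ)).card) :
    ∀ i : Fin (2*g), π i.rev = (π i).rev := by
  suffices h : (Fin.revPerm.trans π).trans Fin.revPerm = π by
    intro i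
    have := congrArg Fin.rev (Equiv.congr_fun h i)
    simpa using this
  apply perm_eq_of_card_filter_eq
  intro a b ha hb
  let i : Fin (2*g+1) := Fin.rev ⟨a, by omega⟩
  let j : Fin (2*g+1) := Fin.rev ⟨b, by omega⟩
  have hi : (i : ℕ) = 2*g - a := by simp [i, Fin.val_rev]
  have hj : (j : ℕ) = 2*g - b := by simp [j, Fin.val_rev]
  have hcount := card_filter_rev_conj π (show 2*g - a ≤ 2*g by omega)
    (show 2*g - b ≤ 2*g by omega)
  rw [Nat.sub_sub_self ha, Nat.sub_sub_self hb] at hcount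
  have hrank := hπ i j
  rw [hi, hj] at hrank
  have hrank_rev := hπ i.rev j.rev
  rw [← hFsymp, ← hGsymp, ← bilinOrthogonal_sup] at hrank_rev
  simp only [i, j, Fin.rev_rev] at hrank_rev
  have hperp := finrank_add_finrank_bilinOrthogonal halt hnd (F i ⊔ G j)
  have hsup := Submodule.finrank_sup_add_finrank_inf_eq (F i) (G j)
  rw [hFrank, hGrank, hi, hj] at hsup
  simp only [Equiv.trans_apply, Fin.revPerm_apply]
  simp only [i, j] at hperp hsup hrank
  omega
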